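/- arXiv:2108.03417 — 2 statements merged into one kernel-verified Lean document; each statement's English description precedes it below -/
import Mathlib

section
/- Let α ∈ (1,2), T > 0, let (λ_n) be a sequence of positive reals, and let (a_n), (b_n) be real sequences with ∑_n λ_n^{3/2} a_n² < ∞ and ∑_n λ_n^{1/2} b_n² < ∞. Then for every t ∈ [0,T] the sequence ( λ_n^{3/4} ( a_n E_α(−λ_n t^α) + b_n t E_{α,2}(−λ_n t^α) ) )_n belongs to ℓ², and the map from [0,T] to ℓ² defined by t ↦ ( λ_n^{3/4} ( a_n E_α(−λ_n t^α) + b_n t E_{α,2}(−λ_n t^α) ) )_n is continuous on [0,T]. (This expresses that the solution series of the fractional Petrovsky system belongs to C([0,T]; D(A^{3/4})).) -/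
/-- The Mittag-Leffler function `E_{α,β}(x) = ∑_{k=0}^∞ x^k / Γ(αk + β)` for real `x`. -/
noncomputable def mittagLeffler (α β x : ℝ) : ℝ :=
  ∑' k : ℕ, x ^ k / Real.Gamma (α * k + β)

/-- The `n`-th coefficient sequence `λ_n^{3/4} ( a_n E_α(-λ_n t^α) + b_n t E_{α,2}(-λ_n t^α) )`
of the solution series of the fractional Petrovsky system, measured in `D(A^{3/4})`. -/
noncomputable def petrovskySeq (α : ℝ) (lam a b : ℕ → ℝ) (t : ℝ) (n : ℕ) : ℝ :=
  (lam n) ^ ((3 : ℝ) / 4) *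
    (a n * mittagLeffler α 1 (-(lam n) * t ^ α) +
      b n * t * mittagLeffler α 2 (-(lam n) * t ^ α))


open MeasureTheory Set Filter Topology

theorem ml_gamma_bound (α β : ℝ) (hα : 1 < α) (hβ : 1 ≤ β) :
    ∃ C : ℝ, 0 < C ∧ ∀ k : ℕ, 1 / Real.Gamma (α * k + β) ≤ C / (k.factorial : ℝ) := by
  refine ⟨max 1 (1 / Real.Gamma β), by positivity, ?_⟩
  intro k
  rcases Nat.eq_zero_or_pos k with rfl | hk
  · simp
  · have hk1 : (1 : ℝ) ≤ k := by exact_mod_cast hk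
    have h1 : (k : ℝ) + 1 ≤ α * k + β := by nlinarith
    have h2 : Real.Gamma (k + 1) ≤ Real.Gamma (α * k + β) :=
      Real.Gamma_strictMonoOn_Ici.monotoneOn (by simp; linarith) (by simp; linarith) h1
    rw [Real.Gamma_nat_eq_factorial] at h2
    have hf : (0 : ℝ) < k.factorial := by exact_mod_cast k.factorial_pos
    calc 1 / Real.Gamma (α * k + β) ≤ 1 / (k.factorial : ℝ) := by gcongr
      _ ≤ _ := by gcongr; exact le_max_left _ _

theorem ml_gamma_pos (α β : ℝ) (hα : 1 < α) (hβ : 1 ≤ β) (k : ℕ) :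
    0 < Real.Gamma (α * k + β) := Real.Gamma_pos_of_pos (by positivity)

theorem ml_term_bound (α β : ℝ) (hα : 1 < α) (hβ : 1 ≤ β) :
    ∃ C : ℝ, 0 < C ∧ ∀ (k : ℕ) (x M : ℝ), |x| ≤ M →
      ‖x ^ k / Real.Gamma (α * k + β)‖ ≤ C * (M ^ k / (k.factorial : ℝ)) := by
  obtain ⟨C, hC, h⟩ := ml_gamma_bound α β hα hβ
  refine ⟨C, hC, fun k x M hx => ?_⟩
  have hp := ml_gamma_pos α β hα hβ k
  rw [norm_div, norm_pow, Real.norm_eq_abs, Real.norm_eq_abs, abs_of_pos hp]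
  calc |x| ^ k / Real.Gamma (α * k + β) = |x| ^ k * (1 / Real.Gamma (α * k + β)) := by ring
    _ ≤ M ^ k * (C / k.factorial) := by
        have h1 : |x| ^ k ≤ M ^ k := by gcongr
        exact mul_le_mul h1 (h k) (by positivity) ((by positivity : (0:ℝ) ≤ |x| ^ k).trans h1)
    _ = _ := by ring

theorem ml_hasSum (α β : ℝ) (hα : 1 < α) (hβ : 1 ≤ β) (x : ℝ) :
    HasSum (fun k : ℕ => x ^ k / Real.Gamma (α * k + β)) (mittagLeffler α β x) := by
  obtain ⟨C, hC, h⟩ := ml_term_bound α β hα hβ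
  exact (Summable.of_norm_bounded ((Real.summable_pow_div_factorial |x|).mul_left C)
    (fun k => h k x |x| le_rfl)).hasSum

theorem ml_continuous (α β : ℝ) (hα : 1 < α) (hβ : 1 ≤ β) :
    Continuous (mittagLeffler α β) := by
  obtain ⟨C, hC, h⟩ := ml_term_bound α β hα hβ
  rw [continuous_iff_continuousAt]
  intro x
  have : ContinuousOn (mittagLeffler α β) (Metric.ball 0 (|x| + 1)) := by
    unfold mittagLeffler
    refine continuousOn_tsum (u := fun k => C * ((|x| + 1) ^ k / (k.factorial : ℝ))) ?_
      ((Real.summable_pow_div_factorial (|x| + 1)).mul_left C) ?_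
    · intro k; fun_prop
    · intro k y hy
      apply h
      simpa using (mem_ball_zero_iff.mp hy).le
  exact this.continuousAt (Metric.isOpen_ball.mem_nhds (by simp))

theorem beta_conv (p q t : ℝ) (hp : 0 < p) (hq : 0 < q) (ht : 0 < t) :
    ∫ s in (0:ℝ)..t, (t - s) ^ (p - 1) * s ^ (q - 1) =
      Real.Gamma p * Real.Gamma q / Real.Gamma (p + q) * t ^ (p + q - 1) := by
  have h1 := Complex.betaIntegral_scaled (q : ℂ) (p : ℂ) ht
  have h2 := Complex.Gamma_mul_Gamma_eq_betaIntegral (s := (q : ℂ)) (t := (p : ℂ))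
    (by simpa) (by simpa)
  have h3 : ∫ x in (0:ℝ)..t, (x : ℂ) ^ ((q : ℂ) - 1) * ((t : ℂ) - x) ^ ((p : ℂ) - 1) =
      ((∫ s in (0:ℝ)..t, (t - s) ^ (p - 1) * s ^ (q - 1) : ℝ) : ℂ) := by
    rw [← intervalIntegral.integral_ofReal]
    apply intervalIntegral.integral_congr
    intro s hs
    rw [uIcc_of_le ht.le] at hs
    have e1 : (((t - s) ^ (p - 1) : ℝ) : ℂ) = ((t : ℂ) - s) ^ ((p : ℂ) - 1) := by
      rw [Complex.ofReal_cpow (by linarith [hs.2])]; push_cast; rfl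
    have e2 : ((s ^ (q - 1) : ℝ) : ℂ) = (s : ℂ) ^ ((q : ℂ) - 1) := by
      rw [Complex.ofReal_cpow hs.1]; push_cast; rfl
    simp only [Complex.ofReal_mul]
    rw [e1, e2, mul_comm]
  rw [h3] at h1
  have h4 : ((t ^ (p + q - 1) : ℝ) : ℂ) = (t : ℂ) ^ ((q : ℂ) + p - 1) := by
    rw [Complex.ofReal_cpow ht.le]; push_cast; congr 1; ring
  rw [← h4] at h1
  have hG : Real.Gamma (p + q) ≠ 0 := (Real.Gamma_pos_of_pos (by positivity)).ne'
  rw [← Complex.ofReal_add, Complex.Gamma_ofReal, Complex.Gamma_ofReal, Complex.Gamma_ofReal] at h2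
  have hGc : (Real.Gamma (q + p) : ℂ) ≠ 0 := by rw [add_comm]; exact_mod_cast hG
  have h5 : Complex.betaIntegral q p =
      ((Real.Gamma p * Real.Gamma q / Real.Gamma (p + q) : ℝ) : ℂ) := by
    push_cast
    rw [add_comm p q, eq_div_iff hGc, mul_comm, ← h2, mul_comm]
  rw [h5] at h1
  rw [mul_comm]
  exact_mod_cast h1

/-- `f_β(t) = t^{β-1} E_{α,β}(-t^α)`. -/
noncomputable def mlf (α β t : ℝ) : ℝ := t ^ (β - 1) * mittagLeffler α β (-t ^ α)

theorem mlf_continuous (α β : ℝ) (hα : 1 < α) (hβ : 1 ≤ β) : Continuous (mlf α β) := by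
  unfold mlf
  exact (Real.continuous_rpow_const (by linarith)).mul
    ((ml_continuous α β hα hβ).comp (Real.continuous_rpow_const (by linarith)).neg)

theorem mlf_conv (α β p t : ℝ) (hα : 1 < α) (hβ : 1 ≤ β) (hp : 0 < p) (ht : 0 < t) :
    ∫ s in (0:ℝ)..t, (t - s) ^ (p - 1) * mlf α β s = Real.Gamma p * mlf α (β + p) t := by
  obtain ⟨C, hC, hb⟩ := ml_term_bound α β hα hβ
  have key : HasSum (fun k : ℕ => ∫ s in (0:ℝ)..t, (t - s) ^ (p - 1) *
      (s ^ (β - 1) * ((-s ^ α) ^ k / Real.Gamma (α * k + β))))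
      (∫ s in (0:ℝ)..t, (t - s) ^ (p - 1) * mlf α β s) := by
    have hsum := (((Real.summable_pow_div_factorial (t ^ α)).mul_left C).mul_left (t ^ (β - 1)))
    refine intervalIntegral.hasSum_integral_of_dominated_convergence
      (fun k s => (t - s) ^ (p - 1) *
        (t ^ (β - 1) * (C * ((t ^ α) ^ k / (k.factorial : ℝ))))) ?_ ?_ ?_ ?_ ?_
    · intro k
      apply Measurable.aestronglyMeasurable
      fun_prop
    · intro k
      refine Eventually.of_forall fun s hs => ?_
      rw [uIoc_of_le ht.le] at hs
      rw [norm_mul, norm_mul, Real.norm_of_nonneg (Real.rpow_nonneg (by linarith [hs.2]) _),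
        Real.norm_of_nonneg (Real.rpow_nonneg hs.1.le _)]
      have h0 : 0 ≤ (t - s) ^ (p - 1) := Real.rpow_nonneg (by linarith [hs.2]) _
      have h1 : s ^ (β - 1) ≤ t ^ (β - 1) := Real.rpow_le_rpow hs.1.le hs.2 (by linarith)
      have h2 : |(-s ^ α)| ≤ t ^ α := by
        rw [abs_neg, abs_of_nonneg (Real.rpow_nonneg hs.1.le _)]
        exact Real.rpow_le_rpow hs.1.le hs.2 (by linarith)
      have h3 := hb k _ _ h2
      gcongr
    · exact Eventually.of_forall fun s hs => hsum.mul_left _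
    · simp_rw [tsum_mul_left]
      apply IntervalIntegrable.mul_const
      have := (intervalIntegral.intervalIntegrable_rpow' (a := 0) (b := t) (r := p - 1)
        (by linarith)).comp_sub_left t
      simpa using this.symm
    · refine Eventually.of_forall fun s hs => ?_
      exact ((ml_hasSum α β hα hβ (-s ^ α)).mul_left _).mul_left _
  have key2 : HasSum (fun k : ℕ => ∫ s in (0:ℝ)..t, (t - s) ^ (p - 1) *
      (s ^ (β - 1) * ((-s ^ α) ^ k / Real.Gamma (α * k + β))))
      (Real.Gamma p * mlf α (β + p) t) := by
    have := ((ml_hasSum α (β + p) hα (by linarith) (-t ^ α)).mul_left (t ^ (β + p - 1))).mul_left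
      (Real.Gamma p)
    convert! this using 2 with k
    have hk := ml_gamma_pos α β hα hβ k
    have e : ∫ s in (0:ℝ)..t, (t - s) ^ (p - 1) *
      (s ^ (β - 1) * ((-s ^ α) ^ k / Real.Gamma (α * k + β))) =
      ∫ s in (0:ℝ)..t, ((-1) ^ k / Real.Gamma (α * k + β)) *
        ((t - s) ^ (p - 1) * s ^ (α * k + β - 1)) := by
      rw [intervalIntegral.integral_of_le ht.le, intervalIntegral.integral_of_le ht.le]
      refine setIntegral_congr_fun measurableSet_Ioc fun s hs => ?_
      have : s ^ (α * k + β - 1) = s ^ (β - 1) * (s ^ α) ^ k := by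
        rw [← Real.rpow_natCast, ← Real.rpow_mul hs.1.le, ← Real.rpow_add hs.1]
        congr 1; ring
      rw [this, neg_pow]
      ring
    rw [e, intervalIntegral.integral_const_mul, beta_conv p _ t hp (by positivity) ht]
    have e2 : t ^ (p + (α * k + β) - 1) = t ^ (β + p - 1) * (t ^ α) ^ k := by
      rw [← Real.rpow_natCast, ← Real.rpow_mul ht.le, ← Real.rpow_add ht]
      congr 1; ring
    rw [e2, neg_pow (t ^ α), show p + (α * k + β) = α * k + (β + p) by ring]
    have hk2 := ml_gamma_pos α (β + p) hα (by linarith) k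
    field_simp
  exact key.unique key2

theorem mlf_rec (α β t : ℝ) (hα : 1 < α) (hβ : 1 ≤ β) (ht : 0 < t) :
    mlf α β t = t ^ (β - 1) / Real.Gamma β - mlf α (β + α) t := by
  have h := (ml_hasSum α β hα hβ (-t ^ α))
  have h1 := (hasSum_nat_add_iff' 1).mpr h
  have h2 := (ml_hasSum α (β + α) hα (by linarith) (-t ^ α)).mul_left (-t ^ α)
  have h3 := h1.unique (by
    convert! h2 using 2 with k
    rw [show α * ((k + 1 : ℕ) : ℝ) + β = α * k + (β + α) by push_cast; ring]
    ring)
  simp at h3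
  unfold mlf
  have e : t ^ (β + α - 1) = t ^ (β - 1) * t ^ α := by
    rw [← Real.rpow_add ht]; congr 1; ring
  rw [e]
  linear_combination (t ^ (β - 1)) * h3

/-- exponential memory variable -/
noncomputable def expMem (u : ℝ → ℝ) (r t : ℝ) : ℝ :=
  ∫ s in (0:ℝ)..t, Real.exp (-(r * (t - s))) * u s

theorem expMem_hasDerivAt (u : ℝ → ℝ) (hu : Continuous u) (r t : ℝ) :
    HasDerivAt (expMem u r) (u t - r * expMem u r t) t := by
  have e : ∀ t, expMem u r t = Real.exp (-(r * t)) * ∫ s in (0:ℝ)..t, Real.exp (r * s) * u s := by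
    intro t
    unfold expMem
    rw [← intervalIntegral.integral_const_mul]
    congr 1; ext s
    rw [← mul_assoc, ← Real.exp_add]; congr 2; ring
  have h1 : HasDerivAt (fun t => ∫ s in (0:ℝ)..t, Real.exp (r * s) * u s)
      (Real.exp (r * t) * u t) t := by
    have hc : Continuous fun s => Real.exp (r * s) * u s := by fun_prop
    exact intervalIntegral.integral_hasDerivAt_right (hc.intervalIntegrable _ _)
      (hc.stronglyMeasurableAtFilter _ _) hc.continuousAt
  have h2 : HasDerivAt (fun t => Real.exp (-(r * t))) (Real.exp (-(r * t)) * (-(r * 1))) t :=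
    (((hasDerivAt_id t).const_mul r).neg).exp
  have h3 := h2.mul h1
  have h4 : expMem u r = (fun t => Real.exp (-(r * t))) *
      (fun t => ∫ s in (0:ℝ)..t, Real.exp (r * s) * u s) := by
    ext t; exact e t
  rw [h4]
  convert! h3 using 1
  simp only [Pi.mul_apply]
  rw [← mul_assoc (Real.exp _) (Real.exp _), ← Real.exp_add]
  simp
  ring

theorem expMem_continuous (u : ℝ → ℝ) (hu : Continuous u) :
    Continuous (fun p : ℝ × ℝ => expMem u p.2 p.1) := by
  unfold expMem
  exact intervalIntegral.continuous_parametric_intervalIntegral_of_continuous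
    (f := fun (p : ℝ × ℝ) s => Real.exp (-(p.2 * (p.1 - s))) * u s)
    (by simp only [Function.uncurry_def]; fun_prop) continuous_fst

theorem expMem_energy (u : ℝ → ℝ) (hu : Continuous u) (r T : ℝ) (hr : 0 ≤ r) (hT : 0 ≤ T) :
    0 ≤ ∫ t in (0:ℝ)..T, u t * expMem u r t := by
  have hφ : Continuous (expMem u r) := by
    exact (expMem_continuous u hu).comp (Continuous.prodMk continuous_id continuous_const)
  have h0 : expMem u r 0 = 0 := by simp [expMem]
  have hd : ∀ t ∈ uIcc 0 T, HasDerivAt (fun t => (expMem u r t) ^ 2 / 2)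
      (u t * expMem u r t - r * (expMem u r t) ^ 2) t := by
    intro t _
    convert! ((expMem_hasDerivAt u hu r t).pow 2).div_const 2 using 1
    push_cast; ring
  have h1 := intervalIntegral.integral_eq_sub_of_hasDerivAt hd
    (Continuous.intervalIntegrable (by fun_prop) _ _)
  rw [intervalIntegral.integral_sub (Continuous.intervalIntegrable (by fun_prop) _ _)
    (Continuous.intervalIntegrable (by fun_prop) _ _), h0] at h1
  have h2 : 0 ≤ ∫ t in (0:ℝ)..T, r * (expMem u r t) ^ 2 :=
    intervalIntegral.integral_nonneg hT (fun t _ => by positivity)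
  nlinarith [sq_nonneg (expMem u r T)]

theorem expMem_bound (u : ℝ → ℝ) (hu : Continuous u) (M T r t : ℝ) (hr : 0 < r) (ht : 0 ≤ t)
    (htT : t ≤ T) (hM : ∀ s ∈ Icc 0 T, |u s| ≤ M) :
    |expMem u r t| ≤ M * T ∧ |expMem u r t| ≤ M * r⁻¹ := by
  have hM0 : 0 ≤ M := (abs_nonneg _).trans (hM 0 ⟨le_rfl, ht.trans htT⟩)
  have hle : ∀ s ∈ Icc 0 t, |Real.exp (-(r * (t - s))) * u s| ≤ Real.exp (-(r * (t - s))) * M := by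
    intro s hs
    rw [abs_mul, abs_of_pos (Real.exp_pos _)]
    have := hM s ⟨hs.1, hs.2.trans htT⟩
    gcongr
  have h1 : |expMem u r t| ≤ ∫ s in (0:ℝ)..t, Real.exp (-(r * (t - s))) * M := by
    unfold expMem
    refine (intervalIntegral.abs_integral_le_integral_abs ht).trans ?_
    exact intervalIntegral.integral_mono_on ht (Continuous.intervalIntegrable (by fun_prop) _ _)
      (Continuous.intervalIntegrable (by fun_prop) _ _) hle
  constructor
  · refine h1.trans ?_
    calc ∫ s in (0:ℝ)..t, Real.exp (-(r * (t - s))) * M ≤ ∫ s in (0:ℝ)..t, M := by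
          refine intervalIntegral.integral_mono_on ht
            (Continuous.intervalIntegrable (by fun_prop) _ _)
            (Continuous.intervalIntegrable (by fun_prop) _ _) ?_
          intro s hs
          have : Real.exp (-(r * (t - s))) ≤ 1 := by
            rw [Real.exp_le_one_iff]
            have := mul_nonneg hr.le (sub_nonneg.2 hs.2)
            linarith
          nlinarith
      _ = t * M := by simp
      _ ≤ M * T := by nlinarith
  · refine h1.trans ?_
    have hd : ∀ s ∈ uIcc 0 t, HasDerivAt (fun s => Real.exp (-(r * (t - s))) * r⁻¹ * M)
        (Real.exp (-(r * (t - s))) * M) s := by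
      intro s _
      have := ((((((hasDerivAt_id s).const_sub t).const_mul r).neg).exp).mul_const r⁻¹).mul_const M
      convert! this using 1
      simp only [id, Pi.neg_apply]
      field_simp
    rw [intervalIntegral.integral_eq_sub_of_hasDerivAt hd
      (Continuous.intervalIntegrable (by fun_prop) _ _)]
    have : 0 ≤ Real.exp (-(r * (t - 0))) * r⁻¹ * M := by positivity
    simp only [sub_self, mul_zero, neg_zero, Real.exp_zero, one_mul]
    linarith [mul_comm M r⁻¹]

theorem rpow_conv_integrable (γ t : ℝ) (hγ : 0 < γ) (u : ℝ → ℝ) (hu : Continuous u) :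
    IntervalIntegrable (fun s => (t - s) ^ (γ - 1) * u s) volume 0 t := by
  have := (intervalIntegral.intervalIntegrable_rpow' (a := 0) (b := t) (r := γ - 1)
        (by linarith)).comp_sub_left t
  simp only [sub_zero, sub_self] at this
  exact this.symm.mul_continuousOn hu.continuousOn

theorem kernel_rep (γ : ℝ) (hγ : 0 < γ) (hγ1 : γ < 1) (u : ℝ → ℝ) (hu : Continuous u)
    (t : ℝ) (ht : 0 < t) :
    Real.Gamma (1 - γ) * ∫ s in (0:ℝ)..t, (t - s) ^ (γ - 1) * u s =
      ∫ r in Ioi (0:ℝ), r ^ (-γ) * expMem u r t := by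
  have hI : ∀ x > 0, ∫ r in Ioi (0:ℝ), r ^ (-γ) * Real.exp (-(r * x)) =
      x ^ (γ - 1) * Real.Gamma (1 - γ) := by
    intro x hx
    have := Real.integral_rpow_mul_exp_neg_mul_Ioi (a := 1 - γ) (r := x) (by linarith) hx
    rw [show 1 - γ - 1 = -γ by ring] at this
    simp_rw [mul_comm x] at this
    rw [this]
    congr 1
    rw [one_div, Real.inv_rpow hx.le, ← Real.rpow_neg hx.le]; congr 1; ring
  have hint : ∀ x > 0, Integrable (fun r => r ^ (-γ) * Real.exp (-(r * x)))
      (volume.restrict (Ioi (0:ℝ))) := by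
    intro x hx
    refine not_imp_comm.1 integral_undef ?_
    rw [hI x hx]
    have := Real.Gamma_pos_of_pos (show 0 < 1 - γ by linarith)
    positivity
  have hae : ∀ᵐ s ∂(volume.restrict (uIoc 0 t)), s ∈ Ioo 0 t := by
    rw [uIoc_of_le ht.le, ← restrict_Ioo_eq_restrict_Ioc]
    exact ae_restrict_mem measurableSet_Ioo
  have hprod : Integrable (Function.uncurry fun s r : ℝ =>
      r ^ (-γ) * Real.exp (-(r * (t - s))) * u s)
      ((volume.restrict (uIoc 0 t)).prod (volume.restrict (Ioi (0:ℝ)))) := by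
    rw [integrable_prod_iff]
    · constructor
      · filter_upwards [hae] with s hs
        exact (hint (t - s) (by linarith [hs.2])).mul_const (u s)
      · have h := (rpow_conv_integrable γ t hγ (fun s => |u s|) hu.abs).mul_const (Real.Gamma (1 - γ))
        rw [intervalIntegrable_iff] at h
        refine h.congr ?_
        filter_upwards [hae] with s hs
        have : ∀ r ∈ Ioi (0:ℝ), ‖Function.uncurry (fun s r : ℝ =>
            r ^ (-γ) * Real.exp (-(r * (t - s))) * u s) (s, r)‖ =
            r ^ (-γ) * Real.exp (-(r * (t - s))) * |u s| := by
          intro r hr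
          simp only [Function.uncurry, norm_mul, Real.norm_eq_abs, Real.abs_exp]
          rw [abs_of_nonneg (Real.rpow_nonneg (le_of_lt hr) _)]
        rw [setIntegral_congr_fun measurableSet_Ioi this, integral_mul_const,
          hI (t - s) (by linarith [hs.2])]
        ring
    · apply Measurable.aestronglyMeasurable
      have := hu.measurable
      simp only [Function.uncurry_def]
      fun_prop
  have hs := intervalIntegral_integral_swap hprod
  rw [← intervalIntegral.integral_const_mul]
  calc _ = ∫ s in (0:ℝ)..t, ∫ r in Ioi (0:ℝ), r ^ (-γ) * Real.exp (-(r * (t - s))) * u s := by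
        rw [intervalIntegral.integral_of_le ht.le, intervalIntegral.integral_of_le ht.le,
          ← uIoc_of_le ht.le]
        refine integral_congr_ae ?_
        filter_upwards [hae] with s hs
        rw [integral_mul_const, hI (t - s) (by linarith [hs.2])]
        ring
    _ = _ := hs
    _ = _ := by
        congr 1; ext r
        unfold expMem
        rw [← intervalIntegral.integral_const_mul]
        congr 1; ext s; ring

theorem pos_kernel (γ : ℝ) (hγ : 0 < γ) (hγ1 : γ < 1) (u : ℝ → ℝ) (hu : Continuous u)
    (T : ℝ) (hT : 0 < T) :
    0 ≤ ∫ t in (0:ℝ)..T, u t * ∫ s in (0:ℝ)..t, (t - s) ^ (γ - 1) * u s := by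
  have hG := Real.Gamma_pos_of_pos (show 0 < 1 - γ by linarith)
  obtain ⟨M, hM⟩ := (isCompact_Icc (a := (0:ℝ)) (b := T)).exists_bound_of_continuousOn
    hu.continuousOn
  have hM' : ∀ s ∈ Icc 0 T, |u s| ≤ M := hM
  have hM0 : 0 ≤ M := (abs_nonneg _).trans (hM 0 ⟨le_rfl, hT.le⟩)
  have hcont := expMem_continuous u hu
  set g : ℝ → ℝ := fun r => if r ≤ 1 then r ^ (-γ) * (M * (M * T)) else r ^ (-γ - 1) * (M * M)
    with hg
  have hgint : Integrable g (volume.restrict (Ioi (0:ℝ))) := by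
    have : Ioi (0:ℝ) = Ioc 0 1 ∪ Ioi 1 := (Ioc_union_Ioi_eq_Ioi zero_le_one).symm
    change IntegrableOn g (Ioi 0)
    rw [this]
    refine IntegrableOn.union ?_ ?_
    · have h := (intervalIntegral.intervalIntegrable_rpow' (a := 0) (b := 1) (r := -γ)
        (by linarith)).mul_const (M * (M * T))
      rw [intervalIntegrable_iff, uIoc_of_le zero_le_one] at h
      refine h.congr_fun (fun r hr => ?_) measurableSet_Ioc
      simp [hg, hr.2]
    · have h := (integrableOn_Ioi_rpow_of_lt (a := -γ - 1) (by linarith) one_pos).mul_const (M * M)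
      refine IntegrableOn.congr_fun h (fun r hr => ?_) measurableSet_Ioi
      simp [hg, not_le.2 (mem_Ioi.1 hr)]
  have hprod : Integrable (Function.uncurry fun t r : ℝ => r ^ (-γ) * (u t * expMem u r t))
      ((volume.restrict (uIoc 0 T)).prod (volume.restrict (Ioi (0:ℝ)))) := by
    have : IsFiniteMeasure (volume.restrict (uIoc 0 T)) := by
      rw [uIoc_of_le hT.le]; infer_instance
    refine (hgint.comp_snd (volume.restrict (uIoc 0 T))).mono' ?_ ?_
    · apply Measurable.aestronglyMeasurable
      have := hu.measurable
      have := hcont.measurable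
      simp only [Function.uncurry_def]
      fun_prop
    · rw [Measure.prod_restrict]
      refine (ae_restrict_iff' (measurableSet_uIoc.prod measurableSet_Ioi)).2
        (Eventually.of_forall ?_)
      rintro ⟨t, r⟩ ⟨ht, hr⟩
      simp only [uIoc_of_le hT.le] at ht
      simp only [mem_Ioi] at hr
      obtain ⟨b1, b2⟩ := expMem_bound u hu M T r t hr ht.1.le ht.2 hM'
      have hb := hM' t ⟨ht.1.le, ht.2⟩
      simp only [Function.uncurry, norm_mul, Real.norm_eq_abs, hg]
      rw [abs_of_nonneg (Real.rpow_nonneg hr.le _)]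
      have hr0 := Real.rpow_nonneg hr.le (-γ)
      split_ifs
      · gcongr
      · rw [Real.rpow_sub_one hr.ne', div_eq_mul_inv, mul_assoc]
        refine mul_le_mul_of_nonneg_left ?_ hr0
        calc |u t| * |expMem u r t| ≤ M * (M * r⁻¹) := by gcongr
          _ = _ := by ring
  have hs := intervalIntegral_integral_swap hprod
  have h1 : Real.Gamma (1 - γ) * ∫ t in (0:ℝ)..T, u t * ∫ s in (0:ℝ)..t, (t - s) ^ (γ - 1) * u s
      = ∫ t in (0:ℝ)..T, ∫ r in Ioi (0:ℝ), r ^ (-γ) * (u t * expMem u r t) := by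
    rw [← intervalIntegral.integral_const_mul, intervalIntegral.integral_of_le hT.le,
      intervalIntegral.integral_of_le hT.le]
    refine setIntegral_congr_fun measurableSet_Ioc fun t ht => ?_
    have := kernel_rep γ hγ hγ1 u hu t ht.1
    calc _ = u t * (Real.Gamma (1 - γ) * ∫ s in (0:ℝ)..t, (t - s) ^ (γ - 1) * u s) := by ring
      _ = _ := by
        rw [this, ← integral_const_mul]
        congr 1; ext r; ring
  have h2 : 0 ≤ ∫ t in (0:ℝ)..T, ∫ r in Ioi (0:ℝ), r ^ (-γ) * (u t * expMem u r t) := by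
    rw [hs]
    refine setIntegral_nonneg measurableSet_Ioi fun r hr => ?_
    rw [intervalIntegral.integral_const_mul]
    exact mul_nonneg (Real.rpow_nonneg (le_of_lt hr) _)
      (expMem_energy u hu r T (le_of_lt hr) hT.le)
  rw [← h1] at h2
  exact nonneg_of_mul_nonneg_right h2 hG

theorem ml_zero (α β : ℝ) (hα : 1 < α) (hβ : 1 ≤ β) :
    mittagLeffler α β 0 = 1 / Real.Gamma β := by
  refine (ml_hasSum α β hα hβ 0).unique ?_
  have := hasSum_single (f := fun k : ℕ => (0:ℝ) ^ k / Real.Gamma (α * k + β)) 0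
    (fun k hk => by simp [hk])
  simpa using this

theorem mlf_prim (α β t : ℝ) (hα : 1 < α) (hβ : 1 ≤ β) (ht : 0 ≤ t) :
    mlf α (β + 1) t = ∫ s in (0:ℝ)..t, mlf α β s := by
  rcases ht.eq_or_lt with rfl | ht
  · simp [mlf, Real.zero_rpow (show β ≠ 0 by linarith)]
  · have := mlf_conv α β 1 t hα hβ one_pos ht
    simpa using this.symm

theorem mlf_one_bound (α : ℝ) (hα : 1 < α) (hα2 : α < 2) (T : ℝ) (hT : 0 ≤ T) :
    |mlf α 1 T| ≤ 1 := by
  rcases hT.eq_or_lt with rfl | hT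
  · have := ml_zero α 1 hα le_rfl
    simp [mlf, Real.zero_rpow (show α ≠ 0 by linarith), this]
  have hu := mlf_continuous α 1 hα le_rfl
  have hv := mlf_continuous α α hα hα.le
  have hpos := pos_kernel (α - 1) (by linarith) (by linarith) (mlf α 1) hu T hT
  have hG := Real.Gamma_pos_of_pos (show 0 < α - 1 by linarith)
  have h1 : ∫ t in (0:ℝ)..T, mlf α 1 t * ∫ s in (0:ℝ)..t, (t - s) ^ (α - 1 - 1) * mlf α 1 s
      = Real.Gamma (α - 1) * ∫ t in (0:ℝ)..T, mlf α 1 t * mlf α α t := by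
    rw [← intervalIntegral.integral_const_mul, intervalIntegral.integral_of_le hT.le,
      intervalIntegral.integral_of_le hT.le]
    refine setIntegral_congr_fun measurableSet_Ioc fun t ht => ?_
    have := mlf_conv α 1 (α - 1) t hα le_rfl (by linarith) ht.1
    rw [show 1 + (α - 1) = α by ring] at this
    calc _ = mlf α 1 t * (Real.Gamma (α - 1) * mlf α α t) := by rw [← this]
      _ = _ := by ring
  rw [h1] at hpos
  have hpos' := nonneg_of_mul_nonneg_right hpos hG
  set U : ℝ → ℝ := fun t => 1 - ∫ s in (0:ℝ)..t, mlf α α s with hU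
  have hUu : ∀ t, 0 < t → mlf α 1 t = U t := by
    intro t ht
    have := mlf_rec α 1 t hα le_rfl ht
    rw [this, hU, add_comm 1 α, mlf_prim α α t hα hα.le ht.le]
    simp
  have hUd : ∀ t, HasDerivAt U (- mlf α α t) t := by
    intro t
    exact (intervalIntegral.integral_hasDerivAt_right (hv.intervalIntegrable _ _)
      (hv.stronglyMeasurableAtFilter _ _) hv.continuousAt).const_sub 1
  have hUc : Continuous U := continuous_iff_continuousAt.2 fun t => (hUd t).continuousAt
  have h2 : ∫ t in (0:ℝ)..T, mlf α 1 t * mlf α α t = ∫ t in (0:ℝ)..T, U t * mlf α α t := by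
    rw [intervalIntegral.integral_of_le hT.le, intervalIntegral.integral_of_le hT.le]
    refine setIntegral_congr_fun measurableSet_Ioc fun t ht => ?_
    simp only [hUu t ht.1]
  rw [h2] at hpos'
  have hd : ∀ t ∈ uIcc 0 T, HasDerivAt (fun t => (U t) ^ 2 / 2) (-(U t * mlf α α t)) t := by
    intro t _
    convert! ((hUd t).pow 2).div_const 2 using 1
    push_cast; ring
  have h3 := intervalIntegral.integral_eq_sub_of_hasDerivAt hd
    (Continuous.intervalIntegrable (by fun_prop) _ _)
  rw [intervalIntegral.integral_neg] at h3
  have hU0 : U 0 = 1 := by simp [hU]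
  rw [hU0] at h3
  rw [hUu T hT]
  apply abs_le_one_iff_mul_self_le_one.2
  nlinarith

theorem mlf_three_bound (α : ℝ) (hα : 1 < α) (hα2 : α < 2) :
    ∃ K : ℝ, 0 ≤ K ∧ ∀ t, 0 ≤ t → |mlf α 3 t| ≤ K * t ^ (2 - α) := by
  have hG := Real.Gamma_pos_of_pos (show 0 < 2 - α by linarith)
  have hG3 := Real.Gamma_pos_of_pos (show 0 < 3 - α by linarith)
  refine ⟨1 / Real.Gamma (3 - α) + 1 / (Real.Gamma (2 - α) * (2 - α)), ?_, ?_⟩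
  · have : 0 < 2 - α := by linarith
    positivity
  intro t ht
  rcases ht.eq_or_lt with rfl | ht
  · rw [mlf, Real.zero_rpow (by norm_num : (3:ℝ) - 1 ≠ 0), Real.zero_rpow (show 2 - α ≠ 0 by linarith)]; simp
  have h1 := mlf_rec α (3 - α) t hα (by linarith) ht
  rw [show 3 - α + α = 3 by ring, show 3 - α - 1 = 2 - α by ring] at h1
  have h2 := mlf_conv α 1 (2 - α) t hα le_rfl (by linarith) ht
  rw [show 1 + (2 - α) = 3 - α by ring] at h2
  have h3 : |∫ s in (0:ℝ)..t, (t - s) ^ (2 - α - 1) * mlf α 1 s| ≤ t ^ (2 - α) / (2 - α) := by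
    have hi := rpow_conv_integrable (2 - α) t (by linarith) (mlf α 1) (mlf_continuous α 1 hα le_rfl)
    have hi1 := rpow_conv_integrable (2 - α) t (by linarith) (fun _ => 1) continuous_const
    refine (intervalIntegral.abs_integral_le_integral_abs ht.le).trans ?_
    calc _ ≤ ∫ s in (0:ℝ)..t, (t - s) ^ (2 - α - 1) * 1 := by
          refine intervalIntegral.integral_mono_on ht.le hi.abs hi1 fun s hs => ?_
          have h0 : 0 ≤ (t - s) ^ (2 - α - 1) := Real.rpow_nonneg (by linarith [hs.2]) _
          rw [abs_mul, abs_of_nonneg h0]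
          have := mlf_one_bound α hα hα2 s hs.1
          gcongr
      _ = ∫ s in (0:ℝ)..t, s ^ (2 - α - 1) := by
          simp only [mul_one]
          rw [intervalIntegral.integral_comp_sub_left (fun x => x ^ (2 - α - 1)) t]
          simp
      _ = _ := by
          rw [integral_rpow (Or.inl (by linarith)), sub_add_cancel,
            Real.zero_rpow (by linarith), sub_zero]
  rw [h2, abs_mul, abs_of_pos hG] at h3
  have h4 : mlf α 3 t = t ^ (2 - α) / Real.Gamma (3 - α) - mlf α (3 - α) t := by linarith
  have h5 : |mlf α (3 - α) t| ≤ 1 / (Real.Gamma (2 - α) * (2 - α)) * t ^ (2 - α) := by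
    have : 0 < 2 - α := by linarith
    rw [← le_div_iff₀' hG] at h3
    refine h3.trans (le_of_eq ?_)
    field_simp
  rw [h4]
  refine (abs_sub _ _).trans ?_
  have : 0 ≤ t ^ (2 - α) := by positivity
  rw [abs_of_nonneg (by positivity)]
  calc _ ≤ t ^ (2 - α) / Real.Gamma (3 - α) + 1 / (Real.Gamma (2 - α) * (2 - α)) * t ^ (2 - α) := by
        gcongr
    _ = _ := by ring

theorem mlf_two_bound (α : ℝ) (hα : 1 < α) (hα2 : α < 2) :
    ∃ C : ℝ, 0 ≤ C ∧ ∀ t, 0 < t → |mlf α 2 t| ≤ C * t ^ (1 - α / 2) := by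
  obtain ⟨K, hK, hW⟩ := mlf_three_bound α hα hα2
  have hu := mlf_continuous α 1 hα le_rfl
  have hw := mlf_continuous α 2 hα one_le_two
  have p2 : ∀ t, 0 ≤ t → mlf α 2 t = ∫ s in (0:ℝ)..t, mlf α 1 s := by
    intro t ht; rw [← mlf_prim α 1 t hα le_rfl ht]; norm_num
  have p3 : ∀ t, 0 ≤ t → mlf α 3 t = ∫ s in (0:ℝ)..t, mlf α 2 s := by
    intro t ht; rw [← mlf_prim α 2 t hα one_le_two ht]; norm_num
  have lip : ∀ s t, 0 ≤ s → s ≤ t → |mlf α 2 t - mlf α 2 s| ≤ t - s := by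
    intro s t hs hst
    rw [p2 t (hs.trans hst), p2 s hs, intervalIntegral.integral_interval_sub_left
      (hu.intervalIntegrable _ _) (hu.intervalIntegrable _ _)]
    have := intervalIntegral.norm_integral_le_of_norm_le_const (a := s) (b := t) (f := mlf α 1)
      (C := 1) (fun x hx => by
        rw [uIoc_of_le hst] at hx
        exact mlf_one_bound α hα hα2 x (hs.trans hx.1.le))
    rw [one_mul, abs_of_nonneg (by linarith : 0 ≤ t - s)] at this
    exact this
  refine ⟨1 + 2 * K, by positivity, fun t ht => ?_⟩
  set h := t ^ (1 - α / 2) with hh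
  have hpos : 0 < h := by positivity
  rcases le_total t 1 with ht1 | ht1
  · have h1 := lip 0 t le_rfl ht.le
    rw [p2 0 le_rfl] at h1
    simp only [intervalIntegral.integral_same, sub_zero] at h1
    have h2 : t ≤ h := by
      calc t = t ^ (1:ℝ) := (Real.rpow_one t).symm
        _ ≤ _ := Real.rpow_le_rpow_of_exponent_ge ht ht1 (by linarith)
    nlinarith
  · have hht : h ≤ t := by
      calc h ≤ t ^ (1:ℝ) := Real.rpow_le_rpow_of_exponent_le ht1 (by linarith)
        _ = t := Real.rpow_one t
    have hsq : t ^ (2 - α) = h * h := by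
      rw [hh, ← Real.rpow_add ht]; congr 1; ring
    have hs0 : 0 ≤ t - h := by linarith
    have e : h * mlf α 2 t - (mlf α 3 t - mlf α 3 (t - h)) =
        ∫ x in (t - h)..t, (mlf α 2 t - mlf α 2 x) := by
      rw [intervalIntegral.integral_sub (by simp) (hw.intervalIntegrable _ _), p3 t ht.le,
        p3 _ hs0, intervalIntegral.integral_interval_sub_left
        (hw.intervalIntegrable _ _) (hw.intervalIntegrable _ _)]
      simp
    have h1 : |h * mlf α 2 t - (mlf α 3 t - mlf α 3 (t - h))| ≤ h * h := by
      rw [e]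
      have := intervalIntegral.norm_integral_le_of_norm_le_const (a := t - h) (b := t)
        (f := fun x => mlf α 2 t - mlf α 2 x)
        (C := h) (fun x hx => by
          rw [uIoc_of_le (by linarith)] at hx
          exact (lip x t (hs0.trans hx.1.le) hx.2).trans (by linarith [hx.1]))
      rw [sub_sub_cancel, abs_of_pos hpos] at this
      exact this
    have h2 := hW t ht.le
    have h3 := hW (t - h) hs0
    have h4 : (t - h) ^ (2 - α) ≤ t ^ (2 - α) :=
      Real.rpow_le_rpow hs0 (by linarith) (by linarith)
    have h5 : |mlf α 3 (t - h)| ≤ K * t ^ (2 - α) := h3.trans (by gcongr)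
    rw [hsq] at h2 h5
    rw [abs_le] at h1 h2 h5
    have h6 : |h * mlf α 2 t| ≤ h * ((1 + 2 * K) * h) := by
      rw [abs_le]; constructor <;> nlinarith
    rw [abs_mul, abs_of_pos hpos] at h6
    exact le_of_mul_le_mul_left h6 hpos

theorem ml_one_bound (α : ℝ) (hα : 1 < α) (hα2 : α < 2) (x : ℝ) (hx : 0 ≤ x) :
    |mittagLeffler α 1 (-x)| ≤ 1 := by
  have := mlf_one_bound α hα hα2 (x ^ α⁻¹) (by positivity)
  simpa [mlf, Real.rpow_inv_rpow hx (show α ≠ 0 by linarith)] using this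

theorem ml_two_bound (α : ℝ) (hα : 1 < α) (hα2 : α < 2) :
    ∃ C : ℝ, 0 ≤ C ∧ ∀ l t, 0 < l → 0 ≤ t →
      |l ^ ((1:ℝ) / 2) * t * mittagLeffler α 2 (-(l * t ^ α))| ≤ C * t ^ (1 - α / 2) := by
  obtain ⟨C, hC, h⟩ := mlf_two_bound α hα hα2
  refine ⟨C, hC, fun l t hl ht => ?_⟩
  rcases ht.eq_or_lt with rfl | ht
  · simp; positivity
  have hα0 : α ≠ 0 := by linarith
  have h1 := h (l ^ α⁻¹ * t) (by positivity)
  have e1 : (l ^ α⁻¹ * t) ^ α = l * t ^ α := by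
    rw [Real.mul_rpow (by positivity) ht.le, Real.rpow_inv_rpow hl.le hα0]
  have e2 : (l ^ α⁻¹ * t) ^ (1 - α / 2) = l ^ (α⁻¹ - 1 / 2) * t ^ (1 - α / 2) := by
    rw [Real.mul_rpow (by positivity) ht.le, ← Real.rpow_mul hl.le]
    congr 2; field_simp
  rw [mlf, e1, e2, show (2:ℝ) - 1 = 1 by norm_num, Real.rpow_one] at h1
  have hp : 0 < l ^ (α⁻¹ - 1 / 2) := by positivity
  have e3 : l ^ α⁻¹ = l ^ (α⁻¹ - 1 / 2) * l ^ ((1:ℝ) / 2) := by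
    rw [← Real.rpow_add hl]; congr 1; ring
  rw [e3, mul_assoc, mul_assoc, abs_mul, abs_of_pos hp] at h1
  rw [mul_assoc]
  refine le_of_mul_le_mul_left (h1.trans (le_of_eq (by ring))) hp

/-- For `α ∈ (1,2)`, `T > 0`, positive `λ_n` and coefficients with
`∑ λ_n^{3/2} a_n² < ∞`, `∑ λ_n^{1/2} b_n² < ∞`, the sequence
`( λ_n^{3/4} ( a_n E_α(-λ_n t^α) + b_n t E_{α,2}(-λ_n t^α) ) )_n` is in `ℓ²` for each
`t ∈ [0,T]`, and the resulting map `[0,T] → ℓ²` is continuous (in the `ℓ²` distance).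
This expresses `u ∈ C([0,T]; D(A^{3/4}))`. -/
theorem petrovsky_continuous_DA34 (α T : ℝ) (hα₁ : 1 < α) (hα₂ : α < 2) (hT : 0 < T)
    (lam a b : ℕ → ℝ) (hlam : ∀ n, 0 < lam n)
    (ha : Summable fun n => (lam n) ^ ((3 : ℝ) / 2) * (a n) ^ 2)
    (hb : Summable fun n => (lam n) ^ ((1 : ℝ) / 2) * (b n) ^ 2) :
    (∀ t ∈ Set.Icc (0 : ℝ) T, Memℓp (petrovskySeq α lam a b t) 2) ∧
      ∀ t ∈ Set.Icc (0 : ℝ) T, ∀ ε > (0 : ℝ), ∃ δ > (0 : ℝ),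
        ∀ s ∈ Set.Icc (0 : ℝ) T, |s - t| < δ →
          (∑' n, (petrovskySeq α lam a b s n - petrovskySeq α lam a b t n) ^ 2) < ε ^ 2 := by
  obtain ⟨C, hC, hC2⟩ := ml_two_bound α hα₁ hα₂
  have hE1 := ml_continuous α 1 hα₁ le_rfl
  have hE2 := ml_continuous α 2 hα₁ one_le_two
  set D := C * T ^ (1 - α / 2) with hD
  set G : ℕ → ℝ := fun n => 2 * (lam n ^ ((3 : ℝ) / 2) * a n ^ 2) +
    2 * D ^ 2 * (lam n ^ ((1 : ℝ) / 2) * b n ^ 2) with hG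
  have hGs : Summable G := (ha.mul_left 2).add (hb.mul_left (2 * D ^ 2))
  have hbd : ∀ t ∈ Set.Icc (0 : ℝ) T, ∀ n, (petrovskySeq α lam a b t n) ^ 2 ≤ G n := by
    intro t ht n
    have hl := hlam n
    have ht0 : 0 ≤ t := ht.1
    have h1 := ml_one_bound α hα₁ hα₂ (lam n * t ^ α) (by positivity)
    have h2 := hC2 (lam n) t hl ht0
    have h3 : C * t ^ (1 - α / 2) ≤ D := by
      rw [hD]
      have := Real.rpow_le_rpow ht0 ht.2 (show 0 ≤ 1 - α / 2 by linarith)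
      gcongr
    have h4 := h2.trans h3
    set m1 := mittagLeffler α 1 (-(lam n * t ^ α)) with hm1
    set m2 := lam n ^ ((1:ℝ) / 2) * t * mittagLeffler α 2 (-(lam n * t ^ α)) with hm2
    set q := lam n ^ ((1:ℝ) / 4) with hq
    have q2 : lam n ^ ((1:ℝ) / 2) = q ^ 2 := by
      rw [hq, ← Real.rpow_natCast, ← Real.rpow_mul hl.le]; norm_num
    have q3 : lam n ^ ((3:ℝ) / 4) = q ^ 3 := by
      rw [hq, ← Real.rpow_natCast, ← Real.rpow_mul hl.le]; norm_num
    have q6 : lam n ^ ((3:ℝ) / 2) = q ^ 6 := by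
      rw [hq, ← Real.rpow_natCast, ← Real.rpow_mul hl.le]; norm_num
    have e : petrovskySeq α lam a b t n = q ^ 3 * a n * m1 + q * b n * m2 := by
      unfold petrovskySeq
      rw [hm2, hm1, neg_mul, q3, q2]; ring
    have s1 : m1 ^ 2 ≤ 1 := by rw [← sq_abs]; nlinarith [abs_nonneg m1]
    have s2 : m2 ^ 2 ≤ D ^ 2 := by rw [← sq_abs]; gcongr
    simp only [hG]
    rw [e, q6, q2]
    have s3 : (q ^ 3 * a n) ^ 2 * m1 ^ 2 ≤ (q ^ 3 * a n) ^ 2 * 1 := by gcongr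
    have s4 : (q * b n) ^ 2 * m2 ^ 2 ≤ (q * b n) ^ 2 * D ^ 2 := by gcongr
    nlinarith [sq_nonneg (q ^ 3 * a n * m1 - q * b n * m2)]
  have hcont : ∀ n, Continuous fun t => petrovskySeq α lam a b t n := by
    intro n
    unfold petrovskySeq
    have hp : Continuous fun t : ℝ => t ^ α := Real.continuous_rpow_const (by linarith)
    fun_prop
  refine ⟨fun t ht => ?_, fun t ht ε hε => ?_⟩
  · apply memℓp_gen
    refine Summable.of_nonneg_of_le (fun n => by positivity) (fun n => ?_) hGs
    have := hbd t ht n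
    simpa using this
  · have hlim : Tendsto (fun s => ∑' n, (petrovskySeq α lam a b s n - petrovskySeq α lam a b t n) ^ 2)
        (𝓝[Set.Icc 0 T] t) (𝓝 (∑' n : ℕ, (0:ℝ))) := by
      refine tendsto_tsum_of_dominated_convergence (hGs.mul_left 4) ?_ ?_
      · intro n
        have h : Continuous fun s => (petrovskySeq α lam a b s n - petrovskySeq α lam a b t n) ^ 2 :=
          ((hcont n).sub continuous_const).pow 2
        have h2 := (h.tendsto t).mono_left (nhdsWithin_le_nhds (s := Set.Icc 0 T))
        simpa using h2
      · filter_upwards [self_mem_nhdsWithin] with s hs n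
        rw [Real.norm_of_nonneg (sq_nonneg _)]
        nlinarith [hbd s hs n, hbd t ht n,
          sq_nonneg (petrovskySeq α lam a b s n + petrovskySeq α lam a b t n)]
    rw [tsum_zero] at hlim
    have hev := hlim.eventually (gt_mem_nhds (show (0:ℝ) < ε ^ 2 by positivity))
    rw [eventually_nhdsWithin_iff, Metric.eventually_nhds_iff] at hev
    obtain ⟨δ, hδ, h⟩ := hev
    exact ⟨δ, hδ, fun s hs hst => h (by rwa [Real.dist_eq]) hs⟩
end

section
/- Let α ∈ (1,2). There exists C > 0, depending only on α, such that for every sequence (λ_n) of positive reals, all real sequences (a_n), (b_n), and every t > 0: ∑_n λ_n² | a_n E_α(−λ_n t^α) + b_n t E_{α,2}(−λ_n t^α) |² ≤ C t^{−α/2} ∑_n λ_n^{3/2} a_n² + C t^{2−(3/2)α} ∑_n λ_n^{1/2} b_n². (This is the pointwise bound ‖∂_t^α u(t,·)‖²_{L²} ≤ C t^{−α/2}‖∇Δu_0‖² + C t^{2−3α/2}‖∇u_1‖² for the solution series of the fractional Petrovsky system.) -/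
open MeasureTheory Set Filter Topology ProbabilityTheory

lemma ml_int_on {w r : ℝ} (hw : 0 < w) (hr : 0 < r) :
    IntegrableOn (fun x : ℝ => x ^ (w-1) * Real.exp (-r * x)) (Ioi 0) := by
  have := integrableOn_rpow_mul_exp_neg_mul_rpow (p := 1) (s := w-1) (b := r) (by linarith) one_pos hr
  simpa using this

lemma ml_laplace {w : ℝ} (hw : 0 < w) {r : ℂ} (hr : 0 < r.re) :
    ∫ x in Ioi (0:ℝ), ((x ^ (w-1) : ℝ) : ℂ) * Complex.exp (-r * x) = Real.Gamma w * r ^ (-(w:ℂ)) := by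
  let f : ℝ → NNReal := fun x => (x ^ (w-1)).toNNReal
  have hfm : Measurable f := by fun_prop
  let μ : Measure ℝ := (volume.restrict (Ioi (0:ℝ))).withDensity (fun x => (f x : ENNReal))
  have hM : ∀ z : ℂ, complexMGF id μ z = ∫ x in Ioi (0:ℝ), ((x ^ (w-1) : ℝ) : ℂ) * Complex.exp (z * x) := by
    intro z
    simp only [complexMGF, μ]
    rw [integral_withDensity_eq_integral_smul hfm]
    refine setIntegral_congr_fun measurableSet_Ioi fun x hx => ?_
    have : (f x : ℝ) = x ^ (w-1) := Real.coe_toNNReal _ (Real.rpow_nonneg (le_of_lt hx) _)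
    simp only [NNReal.smul_def, this, id, Complex.real_smul]
  have hsub : Iio (0:ℝ) ⊆ integrableExpSet id μ := by
    intro t ht
    have ht : t < 0 := ht
    simp only [integrableExpSet, mem_ofPred_eq, μ, id]
    rw [integrable_withDensity_iff_integrable_smul hfm]
    refine (ml_int_on hw (neg_pos.2 ht)).congr_fun (fun x hx => ?_) measurableSet_Ioi
    have : (f x : ℝ) = x ^ (w-1) := Real.coe_toNNReal _ (Real.rpow_nonneg (le_of_lt hx) _)
    simp only [NNReal.smul_def, this, neg_neg, smul_eq_mul]
  have hint : Iio (0:ℝ) ⊆ interior (integrableExpSet id μ) := interior_maximal hsub isOpen_Iio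
  let U : Set ℂ := {z | z.re < 0}
  have hUo : IsOpen U := isOpen_lt Complex.continuous_re continuous_const
  have hUc : Convex ℝ U := convex_halfSpace_re_lt 0
  have hA : AnalyticOnNhd ℂ (complexMGF id μ) U :=
    fun z hz => analyticAt_complexMGF (hint hz)
  have hB : AnalyticOnNhd ℂ (fun z => (Real.Gamma w : ℂ) * (-z) ^ (-(w:ℂ))) U := by
    apply DifferentiableOn.analyticOnNhd _ hUo
    intro z hz
    have hz : z.re < 0 := hz
    apply DifferentiableAt.differentiableWithinAt
    apply DifferentiableAt.const_mul
    apply DifferentiableAt.cpow_const (by fun_prop)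
    left; simpa using hz
  have hreal : ∀ x : ℝ, x < 0 → complexMGF id μ x = (Real.Gamma w : ℂ) * (-(x:ℂ)) ^ (-(w:ℂ)) := by
    intro x hx
    rw [hM]
    have h := Real.integral_rpow_mul_exp_neg_mul_Ioi hw (neg_pos.2 hx)
    have h2 : (∫ t in Ioi (0:ℝ), ((t ^ (w-1) : ℝ) : ℂ) * Complex.exp (x * t)) =
      ((∫ t in Ioi (0:ℝ), t ^ (w-1) * Real.exp (-(-x * t)) : ℝ) : ℂ) := by
      rw [← integral_complex_ofReal]
      refine setIntegral_congr_fun measurableSet_Ioi fun t ht => ?_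
      simp
    rw [h2, h]
    rw [one_div, Real.inv_rpow (by linarith), ← Real.rpow_neg (by linarith)]
    rw [← Complex.ofReal_neg, ← Complex.ofReal_neg, ← Complex.ofReal_cpow (by linarith)]
    push_cast; ring
  have hE := hA.eqOn_of_preconnected_of_frequently_eq hB hUc.isPreconnected
    (z₀ := (-1:ℂ)) (by simp [U]) ?_
  · have := hE (x := -r) (by simpa [U] using hr)
    rw [hM] at this
    simpa using this
  · have h1 : Tendsto (fun n : ℕ => (((-1 - 1/((n:ℝ)+1) : ℝ)) : ℂ)) atTop (𝓝[≠] (-1:ℂ)) := by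
      apply tendsto_nhdsWithin_iff.2 ⟨?_, ?_⟩
      · have : Tendsto (fun n : ℕ => ((-1 - 1/((n:ℝ)+1) : ℝ))) atTop (𝓝 (-1 - 0)) :=
          tendsto_const_nhds.sub tendsto_one_div_add_atTop_nhds_zero_nat
        have := (Complex.continuous_ofReal.tendsto _).comp this
        simpa [Function.comp_def] using this
      · refine Eventually.of_forall fun n => ?_
        have h : (0:ℝ) < 1/((n:ℝ)+1) := by positivity
        intro h'
        have h' : (((-1 - 1/((n:ℝ)+1) : ℝ)) : ℂ) = -1 := h'
        have := congrArg Complex.re h'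
        rw [Complex.ofReal_re] at this
        simp only [Complex.neg_re, Complex.one_re] at this
        linarith
    refine h1.frequently (Frequently.of_forall fun n => ?_)
    have h : (0:ℝ) < 1/((n:ℝ)+1) := by positivity
    exact hreal _ (by linarith)

lemma ml_norm_sq (c y : ℝ) : ‖(c:ℂ) + y * Complex.I‖ ^ 2 = c^2 + y^2 := by
  rw [← Complex.normSq_eq_norm_sq, Complex.normSq_add_mul_I]

lemma ml_cpow_bound {w : ℝ} (hw : 2 ≤ w) (y : ℝ) :
    ‖((2:ℝ):ℂ) + y * Complex.I‖ ^ (-w) ≤ 2 ^ (2 - w) * (1 + y^2)⁻¹ := by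
  have h := ml_norm_sq 2 y
  set n := ‖((2:ℝ):ℂ) + y * Complex.I‖ with hn
  have h0 : 0 ≤ n := norm_nonneg _
  have h2 : 2 ≤ n := by nlinarith [sq_nonneg y]
  have : n ^ (-w) = n ^ (2 - w) * (n^2)⁻¹ := by
    rw [← Real.rpow_natCast, ← Real.rpow_neg h0, ← Real.rpow_add (by linarith)]; congr 1; push_cast; ring
  rw [this]
  have a1 : n ^ (2-w) ≤ 2 ^ (2-w) := Real.rpow_le_rpow_of_nonpos (by norm_num) h2 (by linarith)
  have a2 : (n^2)⁻¹ ≤ (1+y^2)⁻¹ := by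
    rw [h]; apply inv_anti₀ (by positivity); linarith
  gcongr

lemma ml_line_cont {c : ℝ} (hc : 0 < c) (w : ℝ) :
    Continuous (fun y : ℝ => ((c:ℂ) + y * Complex.I) ^ (-(w:ℂ))) := by
  apply continuous_iff_continuousAt.2 fun y => ?_
  apply ContinuousAt.cpow (by fun_prop) (by fun_prop)
  left; simpa using hc

lemma ml_line_int {w : ℝ} (hw : 2 ≤ w) :
    Integrable (fun y : ℝ => (((2:ℝ):ℂ) + y * Complex.I) ^ (-(w:ℂ))) := by
  refine (integrable_inv_one_add_sq.const_mul (2 ^ (2-w))).mono'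
    (ml_line_cont two_pos w).aestronglyMeasurable (Eventually.of_forall fun y => ?_)
  rw [← Complex.ofReal_neg, Complex.norm_cpow_real]
  exact ml_cpow_bound hw y

lemma ml_inv {w t : ℝ} (hw : 2 ≤ w) (ht : 0 < t) :
    ∫ y : ℝ, Complex.exp ((((2:ℝ):ℂ) + y * Complex.I) * t) * (((2:ℝ):ℂ) + y * Complex.I) ^ (-(w:ℂ))
      = ((2 * Real.pi * t ^ (w-1) / Real.Gamma w : ℝ) : ℂ) := by
  have hG := Real.Gamma_pos_of_pos (show 0 < w by linarith)
  let f : ℝ → ℂ := (Ioi (0:ℝ)).indicator (fun x => ((x ^ (w-1) * Real.exp (-2 * x) : ℝ) : ℂ))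
  have hf : Integrable f := by
    rw [integrable_indicator_iff measurableSet_Ioi]
    exact (ml_int_on (by linarith) two_pos).ofReal
  have hF : ∀ ξ : ℝ, FourierTransform.fourier f ξ = Real.Gamma w *
      (((2:ℝ):ℂ) + (2 * Real.pi * ξ : ℝ) * Complex.I) ^ (-(w:ℂ)) := by
    intro ξ
    rw [Real.fourier_real_eq_integral_exp_smul]
    rw [← ml_laplace (by linarith) (by simp)]
    rw [← integral_indicator measurableSet_Ioi]
    congr 1; ext x
    by_cases hx : x ∈ Ioi (0:ℝ)
    · simp only [f, indicator_of_mem hx, smul_eq_mul]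
      push_cast
      rw [mul_left_comm, ← Complex.exp_add]
      congr 2; ring
    · simp [f, indicator_of_notMem hx]
  have hF' : Integrable (FourierTransform.fourier f) := by
    rw [show FourierTransform.fourier f = _ from funext hF]
    apply Integrable.const_mul
    exact (ml_line_int hw).comp_mul_left' (by positivity : (2 * Real.pi) ≠ 0)
  have hv : ContinuousAt f t := by
    have : (fun x : ℝ => ((x ^ (w-1) * Real.exp (-2 * x) : ℝ) : ℂ)) =ᶠ[𝓝 t] f := by
      filter_upwards [Ioi_mem_nhds ht] with x hx
      simp only [f, indicator_of_mem (show x ∈ Ioi (0:ℝ) from hx)]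
    refine ContinuousAt.congr ?_ this
    apply Complex.continuous_ofReal.continuousAt.comp
    exact (Real.continuousAt_rpow_const _ _ (Or.inl ht.ne')).mul (by fun_prop)
  have h := hf.fourierInv_fourier_eq hF' hv
  rw [Real.fourierInv_eq'] at h
  simp only [hF, f, indicator_of_mem (show t ∈ Ioi (0:ℝ) from ht)] at h
  have hcv := Measure.integral_comp_mul_left (fun y : ℝ => Complex.exp ((((2:ℝ):ℂ) + y * Complex.I) * t) * (((2:ℝ):ℂ) + y * Complex.I) ^ (-(w:ℂ))) (2 * Real.pi)
  have hEq : (∫ ξ : ℝ, Complex.exp ((((2:ℝ):ℂ) + (2 * Real.pi * ξ : ℝ) * Complex.I) * t) * (((2:ℝ):ℂ) + (2 * Real.pi * ξ : ℝ) * Complex.I) ^ (-(w:ℂ))) = Complex.exp (2 * t) * (Real.Gamma w : ℂ)⁻¹ * ((t ^ (w-1) * Real.exp (-2 * t) : ℝ) : ℂ) := by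
    rw [← h, ← integral_const_mul]
    congr 1; ext ξ
    have : (Real.Gamma w : ℂ) ≠ 0 := by exact_mod_cast hG.ne'
    simp only [smul_eq_mul, RCLike.inner_apply, conj_trivial]
    rw [show (((2:ℝ):ℂ) + (2 * Real.pi * ξ : ℝ) * Complex.I) * t = 2 * t + ((2 * Real.pi * (t * ξ) : ℝ) : ℂ) * Complex.I by push_cast; ring, Complex.exp_add]
    field_simp
  rw [hEq] at hcv
  rw [abs_of_pos (by positivity), Complex.real_smul, eq_comm, ] at hcv
  have hpi : ((2 * Real.pi : ℝ) : ℂ) ≠ 0 := by exact_mod_cast (by positivity : (2 * Real.pi) ≠ 0)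
  rw [Complex.ofReal_inv, inv_mul_eq_iff_eq_mul₀ hpi] at hcv
  rw [hcv]
  push_cast
  rw [show Complex.exp (-2 * t) = (Complex.exp (2*t))⁻¹ by rw [← Complex.exp_neg]; congr 1; ring]
  have := Complex.exp_ne_zero (2*t)
  field_simp

noncomputable def mlG (α β : ℝ) (s : ℂ) : ℂ :=
  s ^ (-((β + 1 : ℝ) : ℂ)) * (β / (1 + s ^ (-(α:ℂ))) - α * s ^ (-(α:ℂ)) / (1 + s ^ (-(α:ℂ)))^2)

lemma ml_one_add {α : ℝ} (h1 : 1 < α) (h2 : α < 2) :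
    ∃ c > (0:ℝ), ∀ s : ℂ, 0 < s.re → c * (1 + ‖s‖ ^ (-α)) ≤ ‖1 + s ^ (-(α:ℂ))‖ := by
  set κ := Real.cos (α * (Real.pi / 2)) with hκ
  have hpi := Real.pi_pos
  have hκ1 : -1 < κ := by
    rw [← Real.cos_pi]
    apply Real.cos_lt_cos_of_nonneg_of_le_pi (by positivity) le_rfl
    nlinarith
  have hκ0 : κ ≤ 0 := by
    apply Real.cos_nonpos_of_pi_div_two_le_of_le <;> nlinarith
  have hq : 0 < (1 + κ)/2 := by linarith
  refine ⟨Real.sqrt ((1 + κ)/2), Real.sqrt_pos.2 hq, fun s hs => ?_⟩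
  have hs0 : s ≠ 0 := by rintro rfl; simp at hs
  set P := s ^ (-(α:ℂ)) with hP
  have hPn : ‖P‖ = ‖s‖ ^ (-α) := by rw [hP, ← Complex.ofReal_neg, Complex.norm_cpow_real]
  have hre : P.re = ‖P‖ * Real.cos (α * s.arg) := by
    rw [hPn, hP, Complex.cpow_def_of_ne_zero hs0, Complex.exp_re]
    have e1 : (Complex.log s * (-(α:ℂ))).re = Real.log ‖s‖ * (-α) := by
      simp [Complex.log_re]
    have e2 : (Complex.log s * (-(α:ℂ))).im = -(α * s.arg) := by
      simp [Complex.log_im, mul_comm]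
    rw [e1, e2, Real.cos_neg, Real.rpow_def_of_pos (norm_pos_iff.2 hs0)]
  have hcos : κ ≤ Real.cos (α * s.arg) := by
    rw [← Real.cos_abs (α * s.arg), abs_mul, abs_of_pos (by linarith : 0 < α)]
    have : |s.arg| < Real.pi / 2 := Complex.abs_arg_lt_pi_div_two_iff.2 (Or.inl hs)
    have h0 := abs_nonneg s.arg
    apply Real.cos_le_cos_of_nonneg_of_le_pi
    · positivity
    · nlinarith
    · nlinarith
  rw [← hPn]
  have hr := norm_nonneg P
  have hsq : ‖1 + P‖^2 = 1 + 2 * P.re + ‖P‖^2 := by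
    rw [← Complex.normSq_eq_norm_sq, ← Complex.normSq_eq_norm_sq, Complex.normSq_apply, Complex.normSq_apply]
    simp; ring
  refine (sq_le_sq₀ (by positivity) (norm_nonneg _)).1 ?_
  rw [mul_pow, Real.sq_sqrt hq.le, hsq, hre]
  have := mul_le_mul_of_nonneg_left hcos hr
  nlinarith [mul_nonneg (by linarith : (0:ℝ) ≤ 1 - κ) (sq_nonneg (1 - ‖P‖))]

lemma ml_ne {α : ℝ} (h1 : 1 < α) (h2 : α < 2) {s : ℂ} (hs : 0 < s.re) : 1 + s ^ (-(α:ℂ)) ≠ 0 := by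
  obtain ⟨c, hc, h⟩ := ml_one_add h1 h2
  have := h s hs
  intro h0
  rw [h0, norm_zero] at this
  have : 0 < c * (1 + ‖s‖ ^ (-α)) := by positivity
  linarith

lemma ml_G_diff {α : ℝ} (h1 : 1 < α) (h2 : α < 2) (β : ℝ) {s : ℂ} (hs : 0 < s.re) :
    DifferentiableAt ℂ (mlG α β) s := by
  have hm : s ∈ Complex.slitPlane := Or.inl hs
  have a1 : ∀ w : ℂ, DifferentiableAt ℂ (fun s : ℂ => s ^ w) s := fun w =>
    differentiableAt_id.cpow_const hm
  unfold mlG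
  have hne := ml_ne h1 h2 hs
  exact (a1 _).mul (((differentiableAt_const _).div ((a1 _).const_add _) hne).sub
    (((a1 _).const_mul _).div (((a1 _).const_add _).pow 2) (pow_ne_zero 2 hne)))

lemma ml_G_bound {α : ℝ} (h1 : 1 < α) (h2 : α < 2) {β : ℝ} (hβ : 0 < β) :
    ∃ K > (0:ℝ), ∀ s : ℂ, 0 < s.re → ∀ θ : ℝ, 0 ≤ θ → θ ≤ α →
      ‖mlG α β s‖ ≤ K * ‖s‖ ^ (θ - β - 1) := by
  obtain ⟨c, hc, h⟩ := ml_one_add h1 h2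
  refine ⟨β / c + α / c^2, by positivity, fun s hs θ hθ0 hθ1 => ?_⟩
  have hs0 : s ≠ 0 := by rintro rfl; simp at hs
  have hsn : 0 < ‖s‖ := norm_pos_iff.2 hs0
  have hb := h s hs
  unfold mlG
  set P := s ^ (-(α:ℂ)) with hP
  have hPn : ‖P‖ = ‖s‖ ^ (-α) := by rw [hP, ← Complex.ofReal_neg, Complex.norm_cpow_real]
  rw [← hPn] at hb
  have hr := norm_nonneg P
  set r := ‖P‖ with hr'
  have b1 : ‖(β:ℂ) / (1 + P)‖ ≤ β / c / (1 + r) := by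
    rw [norm_div, Complex.norm_real, Real.norm_of_nonneg hβ.le, div_div]
    gcongr
  have b2 : ‖(α:ℂ) * P / (1 + P)^2‖ ≤ α / c^2 / (1 + r) := by
    rw [norm_div, norm_mul, norm_pow, Complex.norm_real, Real.norm_of_nonneg (by linarith : 0 ≤ α)]
    calc α * r / ‖1 + P‖^2 ≤ α * (1 + r) / (c * (1+r))^2 := by
          gcongr; linarith
      _ = _ := by field_simp
  have b3 : 1 / (1 + r) ≤ ‖s‖ ^ θ := by
    rw [div_le_iff₀ (by positivity), hPn, mul_add, mul_one, ← Real.rpow_add hsn]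
    rcases le_total 1 ‖s‖ with hh | hh
    · have := Real.one_le_rpow hh hθ0
      have : 0 ≤ ‖s‖ ^ (θ + -α) := by positivity
      linarith
    · have := Real.one_le_rpow_of_pos_of_le_one_of_nonpos hsn hh (by linarith : θ + -α ≤ 0)
      have : 0 ≤ ‖s‖ ^ θ := by positivity
      linarith
  rw [norm_mul, ← Complex.ofReal_neg, Complex.norm_cpow_real]
  calc ‖s‖ ^ (-(β+1)) * _ ≤ ‖s‖ ^ (-(β+1)) * (β / c / (1 + r) + α / c^2 / (1 + r)) := by
        gcongr
        exact (norm_sub_le _ _).trans (add_le_add b1 b2)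
    _ = ‖s‖ ^ (-(β+1)) * ((β/c + α/c^2) * (1/(1+r))) := by ring
    _ ≤ ‖s‖ ^ (-(β+1)) * ((β/c + α/c^2) * ‖s‖ ^ θ) := by gcongr
    _ = (β/c + α/c^2) * (‖s‖ ^ (-(β+1)) * ‖s‖ ^ θ) := by ring
    _ = _ := by rw [← Real.rpow_add hsn]; congr 2; ring

noncomputable def mlH (α y : ℝ) : ℝ := min (|y| ^ (α/4 - 1)) (|y| ^ (-α/4 - 1))

lemma mlH_int {α : ℝ} (h1 : 0 < α) : Integrable (mlH α) := by
  have hm : Measurable (mlH α) := by unfold mlH; fun_prop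
  have hpos : IntegrableOn (mlH α) (Ioi 0) := by
    rw [← Ioc_union_Ioi_eq_Ioi zero_le_one, integrableOn_union]
    constructor
    · have : IntegrableOn (fun x : ℝ => x ^ (α/4-1)) (Ioc 0 1) := by
        rw [← intervalIntegrable_iff_integrableOn_Ioc_of_le zero_le_one]
        exact intervalIntegral.intervalIntegrable_rpow' (by linarith)
      refine Integrable.mono' this hm.aestronglyMeasurable ?_
      refine (ae_restrict_iff' measurableSet_Ioc).2 (Eventually.of_forall fun x hx => ?_)
      rw [Real.norm_of_nonneg (by unfold mlH; positivity)]
      unfold mlH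
      rw [abs_of_pos hx.1]
      exact min_le_left _ _
    · refine Integrable.mono' (integrableOn_Ioi_rpow_of_lt (a := -α/4-1) (by linarith) one_pos) hm.aestronglyMeasurable ?_
      refine (ae_restrict_iff' measurableSet_Ioi).2 (Eventually.of_forall fun x hx => ?_)
      have hx : 1 < x := hx
      rw [Real.norm_of_nonneg (by unfold mlH; positivity)]
      unfold mlH
      rw [abs_of_pos (by linarith)]
      exact min_le_right _ _
  have hneg : IntegrableOn (mlH α) (Iio 0) := by
    rw [← (Measure.measurePreserving_neg (volume : Measure ℝ)).integrableOn_comp_preimage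
      (Homeomorph.neg ℝ).measurableEmbedding]
    have h2 : (mlH α ∘ Neg.neg) = mlH α := by ext x; simp [mlH]
    have h3 : (Neg.neg ⁻¹' Iio (0:ℝ)) = Ioi 0 := by ext x; simp
    rw [h2, h3]
    exact hpos
  rw [← integrableOn_univ, ← Iio_union_Ici (a := (0:ℝ)), integrableOn_union]
  exact ⟨hneg, (integrableOn_Ici_iff_integrableOn_Ioi (by simp)).2 hpos⟩

lemma ml_G_bound2 {α : ℝ} (h1 : 1 < α) (h2 : α < 2) {β δ : ℝ} (hδ1 : α/4 ≤ δ) (hδ2 : δ ≤ 3*α/4) (hβ : δ < β) :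
    ∃ K > (0:ℝ), ∀ c y : ℝ, 0 < c → y ≠ 0 →
      ‖mlG α β (c + y * Complex.I)‖ ≤ K * c ^ (δ - β) * mlH α y := by
  obtain ⟨K, hK, h⟩ := ml_G_bound h1 h2 (β := β) (by linarith)
  refine ⟨K, hK, fun c y hc hy => ?_⟩
  set s : ℂ := c + y * Complex.I with hs
  have hre : s.re = c := by simp [hs]
  have him : s.im = y := by simp [hs]
  have hyp : 0 < |y| := abs_pos.2 hy
  have n1 : c ≤ ‖s‖ := by rw [← hre]; exact Complex.re_le_norm s
  have n2 : |y| ≤ ‖s‖ := by rw [← him]; exact Complex.abs_im_le_norm s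
  have hsn : 0 < ‖s‖ := by linarith
  have key : ∀ e : ℝ, 0 ≤ δ + e → δ + e ≤ α → e - 1 ≤ 0 → ‖mlG α β s‖ ≤ K * c ^ (δ - β) * |y| ^ (e - 1) := by
    intro e he1 he2 he3
    calc _ ≤ K * ‖s‖ ^ (δ + e - β - 1) := h s (by rw [hre]; exact hc) _ he1 he2
      _ = K * ‖s‖ ^ (δ - β) * ‖s‖ ^ (e - 1) := by
        rw [mul_assoc, ← Real.rpow_add hsn]; congr 2; ring
      _ ≤ _ := by
        have := Real.rpow_le_rpow_of_nonpos hc n1 (by linarith : δ - β ≤ 0)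
        have := Real.rpow_le_rpow_of_nonpos hyp n2 he3
        gcongr
  unfold mlH
  rw [mul_min_of_nonneg _ _ (by positivity)]
  exact le_min (key (α/4) (by linarith) (by linarith) (by linarith)) (key (-α/4) (by linarith) (by linarith) (by linarith))

lemma ml_shift_aux {F : ℂ → ℂ} (hF : ∀ s : ℂ, 0 < s.re → DifferentiableAt ℂ F s)
    {c d : ℝ} (hc : 0 < c) (hcd : c ≤ d)
    (hic : Integrable fun y : ℝ => F (c + y * Complex.I))
    (hid : Integrable fun y : ℝ => F (d + y * Complex.I))
    {φ : ℝ → ℝ} (hφ : Tendsto φ atTop (𝓝 0))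
    (hb : ∀ x ∈ Icc c d, ∀ y : ℝ, y ≠ 0 → ‖F (x + y * Complex.I)‖ ≤ φ |y|) :
    ∫ y : ℝ, F (c + y * Complex.I) = ∫ y : ℝ, F (d + y * Complex.I) := by
  have rect : ∀ Y : ℝ, (∫ x : ℝ in c..d, F (x + (-Y : ℝ) * Complex.I)) - (∫ x : ℝ in c..d, F (x + Y * Complex.I)) +
      Complex.I * (∫ y : ℝ in (-Y)..Y, F (d + y * Complex.I)) -
      Complex.I * (∫ y : ℝ in (-Y)..Y, F (c + y * Complex.I)) = 0 := by
    intro Y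
    have := Complex.integral_boundary_rect_eq_zero_of_differentiableOn F ⟨c, -Y⟩ ⟨d, Y⟩ ?_
    · simpa only [smul_eq_mul] using this
    · intro s hs
      have := hs.1
      simp only [mem_preimage] at this
      rw [uIcc_of_le hcd] at this
      exact (hF s (by linarith [this.1])).differentiableWithinAt
  have hor : ∀ ε : ℝ, (ε = 1 ∨ ε = -1) → Tendsto (fun Y : ℝ => ∫ x : ℝ in c..d, F (x + (ε * Y : ℝ) * Complex.I)) atTop (𝓝 0) := by
    intro ε hε
    have hφ' : Tendsto (fun Y => φ Y * |d - c|) atTop (𝓝 0) := by simpa using hφ.mul_const |d - c|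
    refine squeeze_zero_norm' ?_ hφ'
    filter_upwards [eventually_gt_atTop 0] with Y hY
    refine intervalIntegral.norm_integral_le_of_norm_le_const fun x hx => ?_
    rw [uIoc_of_le hcd] at hx
    have := hb x ⟨hx.1.le, hx.2⟩ (ε * Y) (by rcases hε with rfl | rfl <;> simp [hY.ne'])
    have h3 : |ε * Y| = Y := by rcases hε with rfl | rfl <;> simp [abs_of_pos hY]
    rwa [h3] at this
  have v1 := intervalIntegral_tendsto_integral hic tendsto_neg_atTop_atBot tendsto_id
  have v2 := intervalIntegral_tendsto_integral hid tendsto_neg_atTop_atBot tendsto_id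
  have lim := (((hor (-1) (Or.inr rfl)).sub (hor 1 (Or.inl rfl))).add (v2.const_mul Complex.I)).sub (v1.const_mul Complex.I)
  have lim0 : Tendsto (fun _ : ℝ => (0:ℂ)) atTop (𝓝 0) := tendsto_const_nhds
  have := tendsto_nhds_unique lim (lim0.congr fun Y => by
    have := rect Y
    simp only [neg_one_mul, one_mul, id]
    exact this.symm)
  have h4 : Complex.I * ((∫ y : ℝ, F (d + y * Complex.I)) - ∫ y : ℝ, F (c + y * Complex.I)) = 0 := by
    rw [← this]; ring
  have := (mul_eq_zero.1 h4).resolve_left Complex.I_ne_zero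
  exact (sub_eq_zero.1 this).symm

lemma ml_F_norm (c y t : ℝ) : ‖Complex.exp (((c:ℂ) + y * Complex.I) * t)‖ = Real.exp (c * t) := by
  rw [Complex.norm_exp]; simp

lemma ml_F_diff {α : ℝ} (h1 : 1 < α) (h2 : α < 2) (β t : ℝ) {s : ℂ} (hs : 0 < s.re) :
    DifferentiableAt ℂ (fun s => Complex.exp (s * t) * mlG α β s) s :=
  (by fun_prop : DifferentiableAt ℂ (fun s : ℂ => Complex.exp (s * t)) s).mul (ml_G_diff h1 h2 β hs)

lemma ml_bound_line {α : ℝ} (h1 : 1 < α) (h2 : α < 2) {β δ : ℝ} (hδ1 : α/4 ≤ δ) (hδ2 : δ ≤ 3*α/4) (hβ : δ < β) :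
    ∃ K > (0:ℝ), ∀ t : ℝ, 0 < t →
      ‖∫ y : ℝ, Complex.exp ((((2:ℝ):ℂ) + y * Complex.I) * t) * mlG α β (((2:ℝ):ℂ) + y * Complex.I)‖ ≤ K * t ^ (β - δ) := by
  obtain ⟨K, hK, h⟩ := ml_G_bound2 h1 h2 hδ1 hδ2 hβ
  have hHi := mlH_int (α := α) (by linarith)
  have hH0 : ∀ y, 0 ≤ mlH α y := fun y => by unfold mlH; positivity
  have hI0 : 0 ≤ ∫ y, mlH α y := integral_nonneg hH0
  refine ⟨Real.exp 1 * K * (∫ y, mlH α y) + 1, by positivity, fun t ht => ?_⟩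
  have hae : ∀ᵐ y : ℝ, y ≠ 0 := by
    simp [ae_iff]
  let F : ℂ → ℂ := fun s => Complex.exp (s * t) * mlG α β s
  have hb : ∀ c y : ℝ, 0 < c → y ≠ 0 → ‖F (c + y * Complex.I)‖ ≤ Real.exp (c*t) * (K * c ^ (δ - β)) * mlH α y := by
    intro c y hc hy
    simp only [F]
    rw [norm_mul, ml_F_norm, mul_assoc]
    exact mul_le_mul_of_nonneg_left (h c y hc hy) (by positivity)
  have hint : ∀ c : ℝ, 0 < c → Integrable fun y : ℝ => F (c + y * Complex.I) := by
    intro c hc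
    refine (hHi.const_mul (Real.exp (c*t) * (K * c ^ (δ - β)))).mono' ?_ ?_
    · apply Continuous.aestronglyMeasurable
      apply continuous_iff_continuousAt.2 fun y => ?_
      have := (ml_F_diff h1 h2 β t (s := (c:ℂ) + y * Complex.I) (by simpa using hc)).continuousAt
      exact ContinuousAt.comp (f := fun y : ℝ => (c:ℂ) + y * Complex.I) this (by fun_prop)
    · filter_upwards [hae] with y hy using hb c y hc hy
  have hshift : ∀ c d : ℝ, 0 < c → c ≤ d → ∫ y : ℝ, F (c + y * Complex.I) = ∫ y : ℝ, F (d + y * Complex.I) := by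
    intro c d hc hcd
    refine ml_shift_aux (fun s hs => ml_F_diff h1 h2 β t hs) hc hcd (hint c hc) (hint d (by linarith))
      (φ := fun Y => Real.exp (d*t) * (K * c ^ (δ - β)) * Y ^ (-α/4 - 1)) ?_ ?_
    · have := tendsto_rpow_neg_atTop (y := α/4+1) (by linarith)
      have := this.const_mul (Real.exp (d*t) * (K * c ^ (δ - β)))
      rw [mul_zero] at this
      refine this.congr fun Y => ?_
      congr 2; ring
    · intro x hx y hy
      have hx0 : 0 < x := by linarith [hx.1]
      refine (hb x y hx0 hy).trans ?_
      have e1 : Real.exp (x*t) ≤ Real.exp (d*t) := by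
        apply Real.exp_le_exp.2; exact mul_le_mul_of_nonneg_right hx.2 ht.le
      have e2 := Real.rpow_le_rpow_of_nonpos hc hx.1 (by linarith : δ - β ≤ 0)
      have e3 : mlH α y ≤ |y| ^ (-α/4-1) := min_le_right _ _
      have := hH0 y
      gcongr
  have hE : ∫ y : ℝ, F (((2:ℝ):ℂ) + y * Complex.I) = ∫ y : ℝ, F (((t⁻¹:ℝ):ℂ) + y * Complex.I) := by
    rcases le_total 2 t⁻¹ with h | h
    · exact hshift _ _ two_pos h
    · exact (hshift _ _ (by positivity) h).symm
  change ‖∫ y : ℝ, F (((2:ℝ):ℂ) + y * Complex.I)‖ ≤ _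
  rw [hE]
  calc _ ≤ ∫ y : ℝ, Real.exp (t⁻¹*t) * (K * t⁻¹ ^ (δ - β)) * mlH α y := by
        apply norm_integral_le_of_norm_le (hHi.const_mul _)
        filter_upwards [hae] with y hy using hb _ y (by positivity) hy
    _ = (Real.exp 1 * K * (∫ y, mlH α y)) * t ^ (β - δ) := by
        rw [integral_const_mul, inv_mul_cancel₀ ht.ne', Real.inv_rpow ht.le, ← Real.rpow_neg ht.le, neg_sub]
        ring
    _ ≤ _ := by
        gcongr; linarith

lemma ml_repr {α : ℝ} (h1 : 1 < α) (h2 : α < 2) {β t : ℝ} (hβ : 1 ≤ β) (ht : 0 < t) :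
    ∫ y : ℝ, Complex.exp ((((2:ℝ):ℂ) + y * Complex.I) * t) * mlG α β (((2:ℝ):ℂ) + y * Complex.I)
      = ((2 * Real.pi * t ^ β * mittagLeffler α β (-(t ^ α)) : ℝ) : ℂ) := by
  let f : ℕ → ℝ → ℂ := fun k y => ((-1)^k * (α * k + β) : ℝ) * (Complex.exp ((((2:ℝ):ℂ) + y * Complex.I) * t) * (((2:ℝ):ℂ) + y * Complex.I) ^ (-((α * k + β + 1 : ℝ):ℂ)))
  have hw : ∀ k : ℕ, 2 ≤ α * k + β + 1 := fun k => by
    have : 0 ≤ α * k := by positivity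
    linarith
  have hn : ∀ k y, ‖f k y‖ ≤ ((α * k + β) * (Real.exp (2*t) * 2 ^ (1 - α * k - β))) * (1 + y^2)⁻¹ := by
    intro k y
    have hpos : 0 ≤ α * k + β := by have := hw k; linarith
    simp only [f]
    rw [norm_mul, norm_mul, ml_F_norm, ← Complex.ofReal_neg, Complex.norm_cpow_real, Complex.norm_real,
      norm_mul, norm_pow, norm_neg, norm_one, one_pow, one_mul, Real.norm_of_nonneg hpos]
    have := ml_cpow_bound (hw k) y
    rw [show 2 - (α * k + β + 1) = 1 - α * k - β by ring] at this
    calc _ ≤ (α * k + β) * (Real.exp (2*t) * (2 ^ (1 - α * k - β) * (1 + y^2)⁻¹)) := by gcongr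
      _ = _ := by ring
  have hint : ∀ k, Integrable (f k) := by
    intro k
    refine (integrable_inv_one_add_sq.const_mul _).mono' ?_ (Eventually.of_forall (hn k))
    apply Continuous.aestronglyMeasurable
    exact continuous_const.mul ((by fun_prop : Continuous fun y : ℝ => Complex.exp ((((2:ℝ):ℂ) + y * Complex.I) * t)).mul (ml_line_cont two_pos _))
  have hsumm : Summable fun k : ℕ => (α * k + β) * (Real.exp (2*t) * 2 ^ (1 - α * k - β)) := by
    have hr0 : 0 < (2:ℝ) ^ (-α) := by positivity
    have hr : ‖(2:ℝ) ^ (-α)‖ < 1 := by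
      rw [Real.norm_of_nonneg hr0.le]
      exact Real.rpow_lt_one_of_one_lt_of_neg (by norm_num) (by linarith)
    have s1 := (hasSum_coe_mul_geometric_of_norm_lt_one hr).summable.mul_left (α * Real.exp (2*t) * 2 ^ (1-β))
    have s2 := (summable_geometric_of_norm_lt_one hr).mul_left (β * Real.exp (2*t) * 2 ^ (1-β))
    refine (s1.add s2).congr fun k => ?_
    have : (2:ℝ) ^ (1 - α * k - β) = 2 ^ (1-β) * (2 ^ (-α)) ^ k := by
      rw [← Real.rpow_natCast, ← Real.rpow_mul (by norm_num), ← Real.rpow_add (by norm_num)]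
      congr 1; ring
    rw [this]; ring
  have hsum : Summable fun k => ∫ y, ‖f k y‖ := by
    refine Summable.of_nonneg_of_le (fun k => integral_nonneg fun y => norm_nonneg _) (fun k => ?_)
      (hsumm.mul_right (∫ y : ℝ, (1 + y^2)⁻¹))
    rw [← integral_const_mul]
    exact integral_mono (hint k).norm (integrable_inv_one_add_sq.const_mul _) (hn k)
  have hS := hasSum_integral_of_summable_integral_norm hint hsum
  have hpt : ∀ y : ℝ, ∑' k, f k y = Complex.exp ((((2:ℝ):ℂ) + y * Complex.I) * t) * mlG α β (((2:ℝ):ℂ) + y * Complex.I) := by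
    intro y
    set s : ℂ := ((2:ℝ):ℂ) + y * Complex.I with hs
    have hre : s.re = 2 := by simp [hs]
    have hs0 : s ≠ 0 := by intro h; rw [h] at hre; simp at hre
    have hne := ml_ne h1 h2 (s := s) (by rw [hre]; norm_num)
    have hsn : 2 ≤ ‖s‖ := by rw [← hre]; exact Complex.re_le_norm s
    unfold mlG
    set P := s ^ (-(α:ℂ)) with hP
    have hq : ‖-P‖ < 1 := by
      rw [norm_neg, hP, ← Complex.ofReal_neg, Complex.norm_cpow_real]
      exact Real.rpow_lt_one_of_one_lt_of_neg (by linarith) (by linarith)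
    have g1 := (hasSum_coe_mul_geometric_of_norm_lt_one hq).mul_left (α:ℂ)
    have g2 := (hasSum_geometric_of_norm_lt_one hq).mul_left (β:ℂ)
    have g3 := (g1.add g2).mul_left (Complex.exp (s * t) * s ^ (-((β + 1 : ℝ) : ℂ)))
    have g4 : (fun k => f k y) = fun k : ℕ => Complex.exp (s * t) * s ^ (-((β + 1 : ℝ) : ℂ)) * (α * (k * (-P)^k) + β * (-P)^k) := by
      ext k
      simp only [f]
      rw [← hs]
      have : s ^ (-((α * k + β + 1 : ℝ):ℂ)) = s ^ (-((β + 1 : ℝ) : ℂ)) * P ^ k := by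
        rw [hP, ← Complex.cpow_nat_mul, ← Complex.cpow_add _ _ hs0]
        congr 1; push_cast; ring
      rw [this, neg_pow P]
      push_cast; ring
    rw [g4, g3.tsum_eq, sub_neg_eq_add]
    field_simp
    ring
  simp_rw [hpt] at hS
  have hk : ∀ k, ∫ y, f k y = ((2 * Real.pi * t ^ β * ((-(t^α))^k / Real.Gamma (α * k + β)) : ℝ) : ℂ) := by
    intro k
    simp only [f]
    rw [integral_const_mul, ml_inv (hw k) ht, ← Complex.ofReal_mul]
    congr 1
    have hpos : 0 < α * k + β := by have := hw k; linarith
    have hG := Real.Gamma_pos_of_pos hpos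
    rw [Real.Gamma_add_one hpos.ne', show α * k + β + 1 - 1 = β + α * k by ring, Real.rpow_add ht,
      Real.rpow_mul ht.le, Real.rpow_natCast, neg_pow (t^α)]
    field_simp
  simp_rw [hk] at hS
  rw [← hS.tsum_eq, ← Complex.ofReal_tsum, tsum_mul_left]
  rfl

lemma ml_decay {α : ℝ} (h1 : 1 < α) (h2 : α < 2) {β δ : ℝ} (hβ1 : 1 ≤ β) (hδ1 : α/4 ≤ δ) (hδ2 : δ ≤ 3*α/4) (hβ : δ < β) :
    ∃ K > (0:ℝ), ∀ x : ℝ, 0 < x → |mittagLeffler α β (-x)| ≤ K * x ^ (-(δ/α)) := by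
  obtain ⟨K, hK, h⟩ := ml_bound_line h1 h2 hδ1 hδ2 hβ
  have hpi := Real.pi_pos
  refine ⟨K / (2 * Real.pi), by positivity, fun x hx => ?_⟩
  set t := x ^ (1/α) with htd
  have ht : 0 < t := by positivity
  have htx : t ^ α = x := by
    rw [htd, ← Real.rpow_mul hx.le, one_div, inv_mul_cancel₀ (by linarith), Real.rpow_one]
  have h3 := h t ht
  rw [ml_repr h1 h2 hβ1 ht, Complex.norm_real, htx, norm_mul, Real.norm_of_nonneg (by positivity), Real.norm_eq_abs] at h3
  have : x ^ (-(δ/α)) = t ^ (-δ) := by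
    rw [htd, ← Real.rpow_mul hx.le]; congr 1; ring
  rw [this]
  rw [sub_eq_add_neg, Real.rpow_add ht] at h3
  have hb : 0 < t ^ β := by positivity
  rw [div_mul_eq_mul_div, le_div_iff₀ (by positivity)]
  have : t ^ β * (|mittagLeffler α β (-x)| * (2 * Real.pi)) ≤ t ^ β * (K * t ^ (-δ)) := by linarith
  exact le_of_mul_le_mul_left this hb

theorem petrovsky_caputo_pointwise_bound (α : ℝ) (hα₁ : 1 < α) (hα₂ : α < 2) :
    ∃ C > (0 : ℝ), ∀ lam a b : ℕ → ℝ, (∀ n, 0 < lam n) → ∀ t : ℝ, 0 < t →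
      (∑' n, ENNReal.ofReal ((lam n) ^ (2 : ℝ) *
          (a n * mittagLeffler α 1 (-(lam n) * t ^ α) +
            b n * t * mittagLeffler α 2 (-(lam n) * t ^ α)) ^ 2)) ≤
        ENNReal.ofReal (C * t ^ (-α / 2)) *
            (∑' n, ENNReal.ofReal ((lam n) ^ ((3 : ℝ) / 2) * (a n) ^ 2)) +
          ENNReal.ofReal (C * t ^ (2 - 3 * α / 2)) *
            (∑' n, ENNReal.ofReal ((lam n) ^ ((1 : ℝ) / 2) * (b n) ^ 2)) := by
  obtain ⟨K₁, hK₁, H₁⟩ := ml_decay hα₁ hα₂ (β := 1) (δ := α/4) le_rfl le_rfl (by linarith) (by linarith)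
  obtain ⟨K₂, hK₂, H₂⟩ := ml_decay hα₁ hα₂ (β := 2) (δ := 3*α/4) (by norm_num) (by linarith) le_rfl (by linarith)
  refine ⟨2 * K₁^2 + 2 * K₂^2, by positivity, fun lam a b hlam t ht => ?_⟩
  rw [← ENNReal.tsum_mul_left, ← ENNReal.tsum_mul_left, ← ENNReal.tsum_add]
  refine ENNReal.tsum_le_tsum fun n => ?_
  have hl := hlam n
  rw [← ENNReal.ofReal_mul (by positivity), ← ENNReal.ofReal_mul (by positivity),
    ← ENNReal.ofReal_add (by positivity) (by positivity)]
  apply ENNReal.ofReal_le_ofReal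
  set l := lam n
  have hx : 0 < l * t ^ α := by positivity
  have e1 := H₁ _ hx
  have e2 := H₂ _ hx
  rw [show -(l * t^α) = -l * t^α by ring] at e1 e2
  rw [show α / 4 / α = 1/4 by field_simp] at e1
  rw [show 3 * α / 4 / α = 3/4 by field_simp] at e2
  set E₁ := mittagLeffler α 1 (-l * t ^ α)
  set E₂ := mittagLeffler α 2 (-l * t ^ α)
  have sq : ∀ (E K p : ℝ), 0 < K → |E| ≤ K * (l * t^α) ^ (-p) → E^2 ≤ K^2 * (l ^ (-(2*p)) * t ^ (-(2 * p * α))) := by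
    intro E K p hK h
    have h5 : E^2 ≤ (K * (l * t^α) ^ (-p))^2 := by
      rw [← sq_abs]; gcongr
    refine h5.trans_eq ?_
    rw [mul_pow, ← Real.rpow_mul_natCast hx.le, Real.mul_rpow hl.le (by positivity), ← Real.rpow_mul ht.le]
    congr 3 <;> · push_cast; ring
  have s1 := sq _ _ _ hK₁ e1
  have s2 := sq _ _ _ hK₂ e2
  have m1 : l ^ (2:ℝ) * l ^ (-(2*(1/4:ℝ))) = l ^ ((3:ℝ)/2) := by
    rw [← Real.rpow_add hl]; norm_num
  have m2 : l ^ (2:ℝ) * l ^ (-(2*(3/4:ℝ))) = l ^ ((1:ℝ)/2) := by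
    rw [← Real.rpow_add hl]; norm_num
  have m3 : t ^ (-(2 * (1/4:ℝ) * α)) = t ^ (-α/2) := by congr 1; ring
  have m4 : t ^ 2 * t ^ (-(2 * (3/4:ℝ) * α)) = t ^ (2 - 3*α/2) := by
    rw [← Real.rpow_natCast, ← Real.rpow_add ht]; congr 1; push_cast; ring
  have hl2 : 0 < l ^ (2:ℝ) := by positivity
  have p1 : 0 ≤ t ^ (-α/2) * (l ^ ((3:ℝ)/2) * (a n)^2) := by positivity
  have p2 : 0 ≤ t ^ (2 - 3*α/2) * (l ^ ((1:ℝ)/2) * (b n)^2) := by positivity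
  calc l ^ (2:ℝ) * (a n * E₁ + b n * t * E₂)^2
      ≤ l ^ (2:ℝ) * (2 * (a n)^2 * E₁^2 + 2 * (b n)^2 * t^2 * E₂^2) := by
        gcongr
        nlinarith [sq_nonneg (a n * E₁ - b n * t * E₂)]
    _ ≤ l ^ (2:ℝ) * (2 * (a n)^2 * (K₁^2 * (l ^ (-(2*(1/4:ℝ))) * t ^ (-(2 * (1/4:ℝ) * α)))) + 2 * (b n)^2 * t^2 * (K₂^2 * (l ^ (-(2*(3/4:ℝ))) * t ^ (-(2 * (3/4:ℝ) * α))))) := by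
        gcongr
    _ = 2 * K₁^2 * (t ^ (-α/2) * (l ^ ((3:ℝ)/2) * (a n)^2)) + 2 * K₂^2 * (t ^ (2 - 3*α/2) * (l ^ ((1:ℝ)/2) * (b n)^2)) := by
        rw [← m1, ← m2, ← m4, ← m3]; ring
    _ ≤ _ := by
        nlinarith [mul_nonneg (sq_nonneg K₁) p2, mul_nonneg (sq_nonneg K₂) p1]
end
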